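/- arXiv:1208.0434 — 5 statements merged into one kernel-verified Lean document; each statement's English description precedes it below -/
import Mathlib

section
/- For every p ∈ [1,∞) and every pair of metric measure spaces (X₀,d₀,m₀) and (X₁,d₁,m₁), the infimum in the definition of the L^p-distortion distance DD_p((X₀,d₀,m₀),(X₁,d₁,m₁)) is attained: there exists a coupling μ̄ ∈ Cpl(m₀,m₁) such that DD_p((X₀,d₀,m₀),(X₁,d₁,m₁)) = (∫_{X₀×X₁}∫_{X₀×X₁} |d₀(x₀,y₀) − d₁(x₁,y₁)|^p dμ̄(x₀,x₁) dμ̄(y₀,y₁))^{1/p}. -/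
open MeasureTheory ENNReal

/-- The set of couplings of two measures: measures on the product whose marginals
are the two given measures. -/
def Cpl {α β : Type*} [MeasurableSpace α] [MeasurableSpace β]
    (m₀ : Measure α) (m₁ : Measure β) : Set (Measure (α × β)) :=
  {μ | μ.map Prod.fst = m₀ ∧ μ.map Prod.snd = m₁}

/-- The `L^p`-distortion of a coupling `μ` of two gauged (e.g. metric) measure
spaces with gauges `f₀` and `f₁`:
`(∬ |f₀(x₀,y₀) − f₁(x₁,y₁)|^p dμ dμ)^(1/p)`. -/
noncomputable def distortionP {α β : Type*} [MeasurableSpace α] [MeasurableSpace β] (p : ℝ)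
    (f₀ : α → α → ℝ) (f₁ : β → β → ℝ) (μ : Measure (α × β)) : ℝ≥0∞ :=
  (∫⁻ z, ∫⁻ w, ENNReal.ofReal (|f₀ z.1 w.1 - f₁ z.2 w.2| ^ p) ∂μ ∂μ) ^ (1 / p)

/-- The `L^p`-distortion distance between two gauged (e.g. metric) measure spaces:
the infimum of the `L^p`-distortion over all couplings. -/
noncomputable def DDp {α β : Type*} [MeasurableSpace α] [MeasurableSpace β] (p : ℝ)
    (f₀ : α → α → ℝ) (f₁ : β → β → ℝ) (m₀ : Measure α) (m₁ : Measure β) : ℝ≥0∞ :=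
  ⨅ μ ∈ Cpl m₀ m₁, distortionP p f₀ f₁ μ

/-- Integration against a nonnegative continuous function, bounded or not, is lower
semicontinuous for the weak topology on probability measures. -/
theorem lowerSemicontinuous_lintegral_probabilityMeasure {Ω : Type*} [TopologicalSpace Ω]
    [MeasurableSpace Ω] [OpensMeasurableSpace Ω] {f : Ω → NNReal} (hf : Continuous f) :
    LowerSemicontinuous fun μ : ProbabilityMeasure Ω ↦ ∫⁻ x, (f x : ℝ≥0∞) ∂(μ : Measure Ω) := by
  let g (n : ℕ) : BoundedContinuousFunction Ω NNReal :=
    BoundedContinuousFunction.mkOfBound ⟨fun x ↦ min (f x) n, by fun_prop⟩ n fun x y ↦ by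
      rw [NNReal.dist_eq, abs_le]
      have hx : ((min (f x) n : NNReal) : ℝ) ≤ n := mod_cast min_le_right (f x) n
      have hy : ((min (f y) n : NNReal) : ℝ) ≤ n := mod_cast min_le_right (f y) n
      have hx' : (0 : ℝ) ≤ (min (f x) n : NNReal) := NNReal.coe_nonneg _
      have hy' : (0 : ℝ) ≤ (min (f y) n : NNReal) := NNReal.coe_nonneg _
      simp only [ContinuousMap.coe_mk]
      constructor <;> linarith
  have hg (n : ℕ) (x : Ω) : g n x = min (f x) n := rfl
  have h_sup (x : Ω) : (f x : ℝ≥0∞) = ⨆ n, (g n x : ℝ≥0∞) := by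
    refine le_antisymm ?_ (iSup_le fun n ↦ mod_cast min_le_left _ _)
    obtain ⟨n, hn⟩ := exists_nat_ge (f x)
    refine le_iSup_of_le n ?_
    rw [hg, min_eq_left hn]
  have h_mono : Monotone fun n x ↦ (g n x : ℝ≥0∞) := fun n m hnm x ↦ by
    simp only [hg]
    gcongr
  have h_eq (μ : ProbabilityMeasure Ω) :
      ∫⁻ x, (f x : ℝ≥0∞) ∂(μ : Measure Ω) = ⨆ n, ∫⁻ x, (g n x : ℝ≥0∞) ∂(μ : Measure Ω) := by
    simp_rw [h_sup]
    exact lintegral_iSup (fun n ↦ (g n).continuous.measurable.coe_nnreal_ennreal) h_mono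
  simp_rw [h_eq]
  refine lowerSemicontinuous_iSup fun n ↦ Continuous.lowerSemicontinuous ?_
  exact continuous_iff_continuousAt.2 fun μ ↦
    ProbabilityMeasure.tendsto_iff_forall_lintegral_tendsto.1 Filter.tendsto_id (g n)

/-- The couplings of two probability measures on Polish spaces form a weakly compact set. -/
theorem isCompact_setOf_probabilityMeasure_mem_Cpl {α β : Type*}
    [TopologicalSpace α] [PolishSpace α] [MeasurableSpace α] [BorelSpace α]
    [TopologicalSpace β] [PolishSpace β] [MeasurableSpace β] [BorelSpace β]
    (m₀ : Measure α) (m₁ : Measure β) [IsProbabilityMeasure m₀] [IsProbabilityMeasure m₁] :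
    IsCompact {μ : ProbabilityMeasure (α × β) | (μ : Measure (α × β)) ∈ Cpl m₀ m₁} := by
  have h_closed :
      IsClosed {μ : ProbabilityMeasure (α × β) | (μ : Measure (α × β)) ∈ Cpl m₀ m₁} := by
    let P₀ : ProbabilityMeasure α := ⟨m₀, inferInstance⟩
    let P₁ : ProbabilityMeasure β := ⟨m₁, inferInstance⟩
    have h_eq : {μ : ProbabilityMeasure (α × β) | (μ : Measure (α × β)) ∈ Cpl m₀ m₁} =
        {μ | μ.map measurable_fst.aemeasurable = P₀} ∩
          {μ | μ.map measurable_snd.aemeasurable = P₁} := by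
      ext μ
      exact and_congr
        (ProbabilityMeasure.toMeasure_injective.eq_iff
          (a := μ.map measurable_fst.aemeasurable) (b := P₀))
        (ProbabilityMeasure.toMeasure_injective.eq_iff
          (a := μ.map measurable_snd.aemeasurable) (b := P₁))
    rw [h_eq]
    let := TopologicalSpace.upgradeIsCompletelyMetrizable α
    let := TopologicalSpace.upgradeIsCompletelyMetrizable β
    exact (isClosed_eq (ProbabilityMeasure.continuous_map continuous_fst) continuous_const).inter
      (isClosed_eq (ProbabilityMeasure.continuous_map continuous_snd) continuous_const)
  rw [← h_closed.closure_eq]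
  refine isCompact_closure_of_isTightMeasureSet (IsTightMeasureSet.prodMk ?_ ?_)
  · refine (isTightMeasureSet_singleton (μ := m₀)).subset ?_
    rintro _ ⟨_, ⟨μ, hμ, rfl⟩, rfl⟩
    exact hμ.1
  · refine (isTightMeasureSet_singleton (μ := m₁)).subset ?_
    rintro _ ⟨_, ⟨μ, hμ, rfl⟩, rfl⟩
    exact hμ.2

/-- For continuous gauges, the double integral defining the `L^p`-distortion depends lower
semicontinuously on the measure. -/
theorem lowerSemicontinuous_lintegral_lintegral_abs_sub_rpow {α β : Type*}
    [TopologicalSpace α] [PolishSpace α] [MeasurableSpace α] [BorelSpace α]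
    [TopologicalSpace β] [PolishSpace β] [MeasurableSpace β] [BorelSpace β]
    {p : ℝ} (hp : 0 ≤ p) {f₀ : α → α → ℝ} {f₁ : β → β → ℝ}
    (hf₀ : Continuous fun x : α × α ↦ f₀ x.1 x.2) (hf₁ : Continuous fun x : β × β ↦ f₁ x.1 x.2) :
    LowerSemicontinuous fun μ : ProbabilityMeasure (α × β) ↦
      ∫⁻ z, ∫⁻ w, ENNReal.ofReal (|f₀ z.1 w.1 - f₁ z.2 w.2| ^ p)
        ∂(μ : Measure (α × β)) ∂(μ : Measure (α × β)) := by
  let F : (α × β) × (α × β) → NNReal :=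
    fun q ↦ (|f₀ q.1.1 q.2.1 - f₁ q.1.2 q.2.2| ^ p).toNNReal
  have h₀ : Continuous fun q : (α × β) × (α × β) ↦ f₀ q.1.1 q.2.1 :=
    hf₀.comp (g := fun x : α × α ↦ f₀ x.1 x.2)
      (f := fun q : (α × β) × (α × β) ↦ (q.1.1, q.2.1)) (by fun_prop)
  have h₁ : Continuous fun q : (α × β) × (α × β) ↦ f₁ q.1.2 q.2.2 :=
    hf₁.comp (g := fun x : β × β ↦ f₁ x.1 x.2)
      (f := fun q : (α × β) × (α × β) ↦ (q.1.2, q.2.2)) (by fun_prop)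
  have hF : Continuous F :=
    continuous_real_toNNReal.comp ((h₀.sub h₁).abs.rpow_const fun _ ↦ .inr hp)
  have h_eq (μ : ProbabilityMeasure (α × β)) :
      ∫⁻ z, ∫⁻ w, ENNReal.ofReal (|f₀ z.1 w.1 - f₁ z.2 w.2| ^ p)
        ∂(μ : Measure (α × β)) ∂(μ : Measure (α × β)) =
      ∫⁻ q, (F q : ℝ≥0∞) ∂(μ.prod μ : Measure ((α × β) × (α × β))) := by
    rw [ProbabilityMeasure.toMeasure_prod,
      lintegral_prod _ hF.measurable.coe_nnreal_ennreal.aemeasurable]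
    rfl
  simp_rw [h_eq]
  exact (lowerSemicontinuous_lintegral_probabilityMeasure hF).comp
    (ProbabilityMeasure.continuous_prod.comp (continuous_id.prodMk continuous_id))

/-- For every `p ∈ [1,∞)` and every pair of metric measure spaces,
the infimum in the definition of the `L^p`-distortion distance is attained: there is
a coupling `μ` of `m₀` and `m₁` whose `L^p`-distortion equals `DD_p`. -/
theorem exists_optimal_coupling
    {X₀ X₁ : Type*}
    [MetricSpace X₀] [CompleteSpace X₀] [TopologicalSpace.SeparableSpace X₀]
    [MeasurableSpace X₀] [BorelSpace X₀]
    [MetricSpace X₁] [CompleteSpace X₁] [TopologicalSpace.SeparableSpace X₁]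
    [MeasurableSpace X₁] [BorelSpace X₁]
    (p : ℝ) (hp : 1 ≤ p)
    (m₀ : Measure X₀) (m₁ : Measure X₁)
    [IsProbabilityMeasure m₀] [IsProbabilityMeasure m₁] :
    ∃ μ ∈ Cpl m₀ m₁, distortionP p dist dist μ = DDp p dist dist m₀ m₁ := by
  have hp₀ : 0 < p := zero_lt_one.trans_le hp
  have h_prod : m₀.prod m₁ ∈ Cpl m₀ m₁ := ⟨by simp, by simp⟩
  have := UniformSpace.secondCountable_of_separable X₀
  have := UniformSpace.secondCountable_of_separable X₁
  obtain ⟨μ, hμ, h_min⟩ := LowerSemicontinuousOn.exists_isMinOn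
    ⟨⟨m₀.prod m₁, inferInstance⟩, h_prod⟩
    (isCompact_setOf_probabilityMeasure_mem_Cpl m₀ m₁)
    ((lowerSemicontinuous_lintegral_lintegral_abs_sub_rpow hp₀.le
      continuous_dist continuous_dist).lowerSemicontinuousOn _)
  refine ⟨μ, hμ, le_antisymm (le_iInf₂ fun ν hν ↦ ?_) (iInf₂_le (μ : Measure (X₀ × X₁)) hμ)⟩
  have hν_prob : IsProbabilityMeasure ν := by
    refine ⟨?_⟩
    rw [← Set.preimage_univ (f := Prod.fst), ← Measure.map_apply measurable_fst .univ, hν.1]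
    exact measure_univ
  exact ENNReal.rpow_le_rpow (h_min (a := ⟨ν, hν_prob⟩) hν) (by positivity)
end

section
/- For every p ∈ [1,∞) and every triple of metric measure spaces (X₀,d₀,m₀), (X₁,d₁,m₁), (X₂,d₂,m₂), the L^p-distortion distance satisfies the triangle inequality: DD_p((X₀,d₀,m₀),(X₂,d₂,m₂)) ≤ DD_p((X₀,d₀,m₀),(X₁,d₁,m₁)) + DD_p((X₁,d₁,m₁),(X₂,d₂,m₂)). -/
open MeasureTheory ENNReal

/-- Pushing a composition-product along the base map of a pulled-back kernel. -/
lemma map_compProd_comap {α β γ : Type*} [MeasurableSpace α] [MeasurableSpace β]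
    [MeasurableSpace γ] (μ : Measure α) [SFinite μ] (κ : ProbabilityTheory.Kernel β γ)
    [ProbabilityTheory.IsSFiniteKernel κ] {g : α → β} (hg : Measurable g) :
    (μ.compProd (κ.comap g hg)).map (Prod.map g id) = (μ.map g).compProd κ := by
  refine Measure.ext_of_lintegral _ fun f hf => ?_
  rw [lintegral_map hf (by fun_prop), Measure.lintegral_compProd (by fun_prop),
    Measure.lintegral_compProd hf, lintegral_map (by fun_prop) hg]
  rfl

/-- Gluing lemma: two couplings sharing a marginal are the marginals of a measure on the
triple product. -/
lemma exists_gluing {α β γ : Type*} [MeasurableSpace α] [MeasurableSpace β]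
    [MeasurableSpace γ] [StandardBorelSpace γ] [Nonempty γ]
    (μ : Measure (α × β)) (ν : Measure (β × γ)) [IsFiniteMeasure μ] [IsFiniteMeasure ν]
    (h : μ.map Prod.snd = ν.map Prod.fst) :
    ∃ η : Measure ((α × β) × γ), IsFiniteMeasure η ∧ η.map Prod.fst = μ ∧
      η.map (fun x => (x.1.2, x.2)) = ν := by
  refine ⟨μ.compProd (ν.condKernel.comap Prod.snd measurable_snd), inferInstance,
    Measure.fst_compProd _ _, ?_⟩
  have := map_compProd_comap μ ν.condKernel (measurable_snd (α := α) (β := β))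
  rw [h] at this
  exact this.trans (ν.disintegrate ν.condKernel)

/-- The distortion of a pushforward coupling, as an integral over the product of the source
measure with itself. -/
lemma distortionP_map {Ω α β : Type*} [MeasurableSpace Ω] [MeasurableSpace α]
    [MeasurableSpace β] {p : ℝ} (hp : 0 ≤ p) {f₀ : α → α → ℝ} {f₁ : β → β → ℝ}
    (hf₀ : Measurable (Function.uncurry f₀)) (hf₁ : Measurable (Function.uncurry f₁))
    (η : Measure Ω) [SFinite η] {g : Ω → α} {h : Ω → β} (hg : Measurable g)
    (hh : Measurable h) :
    distortionP p f₀ f₁ (η.map fun x => (g x, h x)) =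
      (∫⁻ q, ENNReal.ofReal |f₀ (g q.1) (g q.2) - f₁ (h q.1) (h q.2)| ^ p ∂(η.prod η)) ^
        (1 / p) := by
  have hφ : Measurable fun x => (g x, h x) := hg.prodMk hh
  have hF : Measurable fun q : (α × β) × (α × β) =>
      ENNReal.ofReal (|f₀ q.1.1 q.2.1 - f₁ q.1.2 q.2.2| ^ p) := by
    have h₀ : Measurable fun q : (α × β) × (α × β) => f₀ q.1.1 q.2.1 :=
      hf₀.comp (measurable_fst.fst.prodMk measurable_snd.fst)
    have h₁ : Measurable fun q : (α × β) × (α × β) => f₁ q.1.2 q.2.2 :=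
      hf₁.comp (measurable_fst.snd.prodMk measurable_snd.snd)
    exact (((h₀.sub h₁).norm).pow_const p).ennreal_ofReal
  rw [distortionP, ← lintegral_prod _ hF.aemeasurable, Measure.map_prod_map _ _ hφ hφ,
    lintegral_map hF (hφ.prodMap hφ)]
  simp only [Prod.map_fst, Prod.map_snd, ENNReal.ofReal_rpow_of_nonneg (abs_nonneg _) hp]

/-- Minkowski's inequality for the distortions of the three pairwise marginals of a measure. -/
lemma distortionP_map_triangle {Ω α β γ : Type*} [MeasurableSpace Ω] [MeasurableSpace α]
    [MeasurableSpace β] [MeasurableSpace γ] {p : ℝ} (hp : 1 ≤ p)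
    {f₀ : α → α → ℝ} {f₁ : β → β → ℝ} {f₂ : γ → γ → ℝ}
    (hf₀ : Measurable (Function.uncurry f₀)) (hf₁ : Measurable (Function.uncurry f₁))
    (hf₂ : Measurable (Function.uncurry f₂))
    (η : Measure Ω) [SFinite η] {a : Ω → α} {b : Ω → β} {c : Ω → γ}
    (ha : Measurable a) (hb : Measurable b) (hc : Measurable c) :
    distortionP p f₀ f₂ (η.map fun x => (a x, c x)) ≤
      distortionP p f₀ f₁ (η.map fun x => (a x, b x)) +
        distortionP p f₁ f₂ (η.map fun x => (b x, c x)) := by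
  have hp₀ : 0 ≤ p := zero_le_one.trans hp
  have h₀ : Measurable fun q : Ω × Ω => f₀ (a q.1) (a q.2) := hf₀.comp (ha.prodMap ha)
  have h₁ : Measurable fun q : Ω × Ω => f₁ (b q.1) (b q.2) := hf₁.comp (hb.prodMap hb)
  have h₂ : Measurable fun q : Ω × Ω => f₂ (c q.1) (c q.2) := hf₂.comp (hc.prodMap hc)
  rw [distortionP_map hp₀ hf₀ hf₂ η ha hc, distortionP_map hp₀ hf₀ hf₁ η ha hb,
    distortionP_map hp₀ hf₁ hf₂ η hb hc]
  refine le_trans ?_ (lintegral_Lp_add_le (h₀.sub h₁).norm.ennreal_ofReal.aemeasurable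
    (h₁.sub h₂).norm.ennreal_ofReal.aemeasurable hp)
  refine ENNReal.rpow_le_rpow (lintegral_mono fun q => ENNReal.rpow_le_rpow ?_ hp₀)
    (by positivity)
  exact (ENNReal.ofReal_le_ofReal (abs_sub_le _ _ _)).trans ENNReal.ofReal_add_le

/-- For every `p ∈ [1,∞)` and every triple of metric measure spaces,
the `L^p`-distortion distance satisfies the triangle inequality. -/
theorem DDp_triangle
    {X₀ X₁ X₂ : Type*}
    [MetricSpace X₀] [CompleteSpace X₀] [TopologicalSpace.SeparableSpace X₀]
    [MeasurableSpace X₀] [BorelSpace X₀]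
    [MetricSpace X₁] [CompleteSpace X₁] [TopologicalSpace.SeparableSpace X₁]
    [MeasurableSpace X₁] [BorelSpace X₁]
    [MetricSpace X₂] [CompleteSpace X₂] [TopologicalSpace.SeparableSpace X₂]
    [MeasurableSpace X₂] [BorelSpace X₂]
    (p : ℝ) (hp : 1 ≤ p)
    (m₀ : Measure X₀) (m₁ : Measure X₁) (m₂ : Measure X₂)
    [IsProbabilityMeasure m₀] [IsProbabilityMeasure m₁] [IsProbabilityMeasure m₂] :
    DDp p dist dist m₀ m₂ ≤ DDp p dist dist m₀ m₁ + DDp p dist dist m₁ m₂ := by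
  have := UniformSpace.secondCountable_of_separable X₀
  have := UniformSpace.secondCountable_of_separable X₁
  have := UniformSpace.secondCountable_of_separable X₂
  have : Nonempty X₂ := nonempty_of_isProbabilityMeasure m₂
  simp only [DDp, ENNReal.iInf_add, ENNReal.add_iInf]
  refine le_iInf₂ fun ν hν => le_iInf₂ fun μ hμ => ?_
  obtain ⟨hμ₀, hμ₁⟩ := hμ
  obtain ⟨hν₁, hν₂⟩ := hν
  have : IsFiniteMeasure (μ.map Prod.fst) := hμ₀ ▸ inferInstance
  have : IsFiniteMeasure (ν.map Prod.fst) := hν₁ ▸ inferInstance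
  have : IsFiniteMeasure μ := Measure.isFiniteMeasure_of_map measurable_fst.aemeasurable
  have : IsFiniteMeasure ν := Measure.isFiniteMeasure_of_map measurable_fst.aemeasurable
  obtain ⟨η, _, rfl, rfl⟩ := exists_gluing μ ν (hμ₁.trans hν₁.symm)
  have hη : η.map (fun x => (x.1.1, x.2)) ∈ Cpl m₀ m₂ := by
    constructor
    · rw [← hμ₀, Measure.map_map (by fun_prop) (by fun_prop),
        Measure.map_map (by fun_prop) (by fun_prop)]
      rfl
    · rw [← hν₂, Measure.map_map (by fun_prop) (by fun_prop),
        Measure.map_map (by fun_prop) (by fun_prop)]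
      rfl
  exact (iInf₂_le _ hη).trans (distortionP_map_triangle hp measurable_dist measurable_dist
    measurable_dist η measurable_fst.fst measurable_fst.snd measurable_snd)
end

section
/- Let (X₀,d₀,m₀) and (X₁,d₁,m₁) be metric measure spaces and suppose there exists a coupling μ̄ ∈ Cpl(m₀,m₁) such that d₀(x₀,y₀) = d₁(x₁,y₁) for μ̄⊗μ̄-almost every ((x₀,x₁),(y₀,y₁)) ∈ (X₀ × X₁)². Then there exists a Borel measurable bijection ψ from the support of m₀ onto the support of m₁, with Borel measurable inverse, such that ψ pushes m₀ forward to m₁ (i.e. ψ_*m₀ = m₁) and pulls back the metric (i.e. d₀(x,y) = d₁(ψ(x),ψ(y)) for all x, y in the support of m₀). -/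
open MeasureTheory

/-- The support of a measure: the set of points all of whose neighbourhoods have
positive measure (equivalently, the smallest closed set of full measure). -/
def mSupport {α : Type*} [TopologicalSpace α] [MeasurableSpace α] (m : Measure α) : Set α :=
  {x | ∀ U ∈ nhds x, 0 < m U}

theorem mSupport_eq_support {α : Type*} [TopologicalSpace α] [MeasurableSpace α]
    (m : Measure α) : mSupport m = m.support :=
  Set.ext fun x => (Measure.mem_support_iff_forall x).symm

/-- A relation that is closed and holds almost everywhere for a product measure holds on the
product of the supports. -/
theorem forall_mem_support_of_ae_prod {α β : Type*} [TopologicalSpace α] [TopologicalSpace β]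
    [MeasurableSpace α] [MeasurableSpace β] {μ : Measure α} {ν : Measure β} [SFinite ν]
    {p : α × β → Prop} (hp : IsClosed {q | p q}) (h : ∀ᵐ q ∂(μ.prod ν), p q)
    {a : α} (ha : a ∈ μ.support) {b : β} (hb : b ∈ ν.support) : p (a, b) := by
  by_contra hab
  obtain ⟨U, hU, V, hV, hUV⟩ := mem_nhds_prod_iff.1 (hp.isOpen_compl.mem_nhds hab)
  have hzero : (μ.prod ν) (U ×ˢ V) = 0 := measure_mono_null hUV h
  rw [Measure.prod_prod] at hzero
  exact mul_ne_zero ((Measure.mem_support_iff_forall a).1 ha U hU).ne'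
    ((Measure.mem_support_iff_forall b).1 hb V hV).ne' hzero

/-- A measurable map that is isometric on the support of a measure maps it onto the support of the
pushforward. -/
theorem image_support_eq_support_map {Z X : Type*} [MetricSpace Z] [CompleteSpace Z]
    [SecondCountableTopology Z] [MeasurableSpace Z] [OpensMeasurableSpace Z]
    [MetricSpace X] [MeasurableSpace X] [BorelSpace X]
    {μ : Measure Z} {f : Z → X} (hf : Continuous f)
    (hdist : ∀ p ∈ μ.support, ∀ q ∈ μ.support, dist (f p) (f q) = dist p q) :
    f '' μ.support = (μ.map f).support := by
  apply Set.Subset.antisymm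
  · rintro _ ⟨p, hp, rfl⟩
    rw [Measure.mem_support_iff_forall] at hp ⊢
    intro U hU
    exact (hp _ (hf.continuousAt hU)).trans_le (Measure.le_map_apply hf.measurable.aemeasurable U)
  · have hiso : Isometry (μ.support.domRestrict f) :=
      Isometry.of_dist_eq fun p q => hdist p p.2 q q.2
    have : CompleteSpace μ.support := Measure.isClosed_support.completeSpace_coe
    have hclosed : IsClosed (f '' μ.support) := by
      rw [← Set.range_domRestrict]
      exact hiso.isClosedEmbedding.isClosed_range
    refine Measure.support_subset_of_isClosed hclosed ?_
    refine (mem_ae_map_iff hf.measurable.aemeasurable hclosed.measurableSet).2 ?_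
    exact Filter.mem_of_superset Measure.support_mem_ae (Set.subset_preimage_image f _)

/-- If there is a coupling `μ` of `m₀` and `m₁` such that
`d₀(x₀,y₀) = d₁(x₁,y₁)` for `μ ⊗ μ`-almost every pair, then there is a Borel
measurable bijection `ψ` from the support of `m₀` onto the support of `m₁`, with
Borel measurable inverse, pushing `m₀` forward to `m₁` and pulling back the metric. -/
theorem exists_measure_preserving_isometry_of_ae_dist_eq
    {X₀ X₁ : Type*}
    [MetricSpace X₀] [CompleteSpace X₀] [TopologicalSpace.SeparableSpace X₀]
    [MeasurableSpace X₀] [BorelSpace X₀]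
    [MetricSpace X₁] [CompleteSpace X₁] [TopologicalSpace.SeparableSpace X₁]
    [MeasurableSpace X₁] [BorelSpace X₁]
    (m₀ : Measure X₀) (m₁ : Measure X₁)
    [IsProbabilityMeasure m₀] [IsProbabilityMeasure m₁]
    (μ : Measure (X₀ × X₁)) (hμ : μ ∈ Cpl m₀ m₁)
    (h : ∀ᵐ q ∂(μ.prod μ), dist q.1.1 q.2.1 = dist q.1.2 q.2.2) :
    ∃ ψ : X₀ → X₁,
      Set.BijOn ψ (mSupport m₀) (mSupport m₁) ∧
      Measurable ((mSupport m₀).restrict ψ) ∧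
      (∃ φ : X₁ → X₀, Measurable ((mSupport m₁).restrict φ) ∧
        Set.InvOn φ ψ (mSupport m₀) (mSupport m₁)) ∧
      m₀.map ψ = m₁ ∧
      ∀ x ∈ mSupport m₀, ∀ y ∈ mSupport m₀, dist x y = dist (ψ x) (ψ y) := by
  have : SecondCountableTopology X₀ := UniformSpace.secondCountable_of_separable X₀
  have : SecondCountableTopology X₁ := UniformSpace.secondCountable_of_separable X₁
  obtain ⟨rfl, rfl⟩ := hμ
  have : IsProbabilityMeasure μ :=
    Measure.isProbabilityMeasure_of_map (μ := μ) Prod.fst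
  have hS : ∀ p ∈ μ.support, ∀ q ∈ μ.support, dist p.1 q.1 = dist p.2 q.2 := fun p hp q hq =>
    forall_mem_support_of_ae_prod (p := fun r => dist r.1.1 r.2.1 = dist r.1.2 r.2.2)
      (isClosed_eq (by fun_prop) (by fun_prop)) h hp hq
  have hfst : Prod.fst '' μ.support = (μ.map Prod.fst).support :=
    image_support_eq_support_map continuous_fst fun p hp q hq => by
      rw [Prod.dist_eq, ← hS p hp q hq, max_self]
  have hsnd : Prod.snd '' μ.support = (μ.map Prod.snd).support :=
    image_support_eq_support_map continuous_snd fun p hp q hq => by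
      rw [Prod.dist_eq, hS p hp q hq, max_self]
  rw [mSupport_eq_support, mSupport_eq_support, ← hfst, ← hsnd]
  obtain ⟨z, -⟩ := Measure.nonempty_support (IsProbabilityMeasure.ne_zero μ)
  have hex₀ : ∀ x : X₀, ∃ y : X₁, x ∈ Prod.fst '' μ.support → (x, y) ∈ μ.support := by
    intro x
    by_cases hx : x ∈ Prod.fst '' μ.support
    · obtain ⟨p, hp, rfl⟩ := hx
      exact ⟨p.2, fun _ => hp⟩
    · exact ⟨z.2, fun hx' => absurd hx' hx⟩
  have hex₁ : ∀ y : X₁, ∃ x : X₀, y ∈ Prod.snd '' μ.support → (x, y) ∈ μ.support := by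
    intro y
    by_cases hy : y ∈ Prod.snd '' μ.support
    · obtain ⟨p, hp, rfl⟩ := hy
      exact ⟨p.1, fun _ => hp⟩
    · exact ⟨z.1, fun hy' => absurd hy' hy⟩
  choose ψ hψ using hex₀
  choose φ hφ using hex₁
  have hψ_eq : ∀ p ∈ μ.support, ψ p.1 = p.2 := fun p hp =>
    dist_eq_zero.1 <| by
      rw [← hS _ (hψ p.1 (Set.mem_image_of_mem _ hp)) p hp, dist_self]
  have hφ_eq : ∀ p ∈ μ.support, φ p.2 = p.1 := fun p hp =>
    dist_eq_zero.1 <| by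
      rw [hS _ (hφ p.2 (Set.mem_image_of_mem _ hp)) p hp, dist_self]
  have hψ_dist : ∀ x ∈ Prod.fst '' μ.support, ∀ y ∈ Prod.fst '' μ.support,
      dist x y = dist (ψ x) (ψ y) := fun x hx y hy => hS _ (hψ x hx) _ (hψ y hy)
  have hψ_iso : Isometry ((Prod.fst '' μ.support).domRestrict ψ) :=
    Isometry.of_dist_eq fun x y => (hψ_dist x x.2 y y.2).symm
  have hφ_iso : Isometry ((Prod.snd '' μ.support).domRestrict φ) :=
    Isometry.of_dist_eq fun x y => hS _ (hφ x x.2) _ (hφ y y.2)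
  have hinv : Set.InvOn φ ψ (Prod.fst '' μ.support) (Prod.snd '' μ.support) :=
    ⟨fun x hx => hφ_eq _ (hψ x hx), fun y hy => hψ_eq _ (hφ y hy)⟩
  refine ⟨ψ, hinv.bijOn (fun x hx => ⟨_, hψ x hx, rfl⟩) (fun y hy => ⟨_, hφ y hy, rfl⟩),
    hψ_iso.continuous.measurable, ⟨φ, hφ_iso.continuous.measurable, hinv⟩, ?_, hψ_dist⟩
  have hmeas : MeasurableSet (Prod.fst '' μ.support) := by
    rw [hfst]
    exact Measure.isClosed_support.measurableSet
  have hψ_ae : AEMeasurable ψ (μ.map Prod.fst) := by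
    have hrestrict : (μ.map Prod.fst).restrict (Prod.fst '' μ.support) = μ.map Prod.fst := by
      rw [hfst]
      exact Measure.restrict_eq_self_of_ae_mem Measure.support_mem_ae
    rw [← hrestrict]
    exact aemeasurable_restrict_of_measurable_subtype hmeas hψ_iso.continuous.measurable
  rw [AEMeasurable.map_map_of_aemeasurable hψ_ae measurable_fst.aemeasurable]
  exact Measure.map_congr (Filter.mem_of_superset Measure.support_mem_ae hψ_eq)
end

section
/- Let 1 ≤ p ≤ q < ∞ and let (X₀,d₀,m₀), (X₁,d₁,m₁) be metric measure spaces of finite L^q-size. Then DD_p((X₀,d₀,m₀),(X₁,d₁,m₁)) ≤ DD_q((X₀,d₀,m₀),(X₁,d₁,m₁)). If moreover the diameters of the supports of m₀ and m₁ are both at most L for some L ∈ [0,∞), then DD_q((X₀,d₀,m₀),(X₁,d₁,m₁))^q ≤ L^{q−p} · DD_p((X₀,d₀,m₀),(X₁,d₁,m₁))^p. -/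
open MeasureTheory ENNReal

lemma ae_mem_mSupport {α : Type*} [TopologicalSpace α] [SecondCountableTopology α]
    [MeasurableSpace α] (m : Measure α) : ∀ᵐ x ∂m, x ∈ mSupport m := by
  refine measure_null_of_locally_null _ fun x hx => ?_
  simp only [mSupport, Set.mem_compl_iff, Set.mem_ofPred_eq, not_forall, not_lt,
    nonpos_iff_eq_zero] at hx
  obtain ⟨U, hU, hU0⟩ := hx
  exact ⟨U, mem_nhdsWithin_of_mem_nhds hU, hU0⟩

lemma Cpl.isProbabilityMeasure {α β : Type*} [MeasurableSpace α] [MeasurableSpace β]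
    {m₀ : Measure α} {m₁ : Measure β} [IsProbabilityMeasure m₀] {μ : Measure (α × β)}
    (hμ : μ ∈ Cpl m₀ m₁) : IsProbabilityMeasure μ := by
  constructor
  rw [← Set.preimage_univ (f := Prod.fst), ← Measure.map_apply measurable_fst .univ, hμ.1,
    measure_univ]

lemma prod_mem_Cpl {α β : Type*} [MeasurableSpace α] [MeasurableSpace β]
    (m₀ : Measure α) (m₁ : Measure β) [IsProbabilityMeasure m₀] [IsProbabilityMeasure m₁] :
    m₀.prod m₁ ∈ Cpl m₀ m₁ := by
  simp [Cpl, Measure.map_fst_prod, Measure.map_snd_prod]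

lemma distortionP_rpow {α β : Type*} [MeasurableSpace α] [MeasurableSpace β] {p : ℝ}
    (hp : p ≠ 0) (f₀ : α → α → ℝ) (f₁ : β → β → ℝ) (μ : Measure (α × β)) :
    distortionP p f₀ f₁ μ ^ p =
      ∫⁻ z, ∫⁻ w, ENNReal.ofReal (|f₀ z.1 w.1 - f₁ z.2 w.2| ^ p) ∂μ ∂μ := by
  rw [distortionP, one_div, ENNReal.rpow_inv_rpow hp]

lemma measurable_gauge_sub {α β : Type*} [MeasurableSpace α] [MeasurableSpace β]
    {f₀ : α → α → ℝ} {f₁ : β → β → ℝ}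
    (hf₀ : Measurable (Function.uncurry f₀)) (hf₁ : Measurable (Function.uncurry f₁)) :
    Measurable fun u : (α × β) × (α × β) => f₀ u.1.1 u.2.1 - f₁ u.1.2 u.2.2 :=
  (hf₀.comp (by fun_prop : Measurable fun u : (α × β) × (α × β) => (u.1.1, u.2.1))).sub
    (hf₁.comp (by fun_prop : Measurable fun u : (α × β) × (α × β) => (u.1.2, u.2.2)))

lemma distortionP_eq_eLpNorm' {α β : Type*} [MeasurableSpace α] [MeasurableSpace β] {p : ℝ}
    (hp : 0 ≤ p) {f₀ : α → α → ℝ} {f₁ : β → β → ℝ} (μ : Measure (α × β)) [SFinite μ]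
    (hf₀ : Measurable (Function.uncurry f₀)) (hf₁ : Measurable (Function.uncurry f₁)) :
    distortionP p f₀ f₁ μ =
      eLpNorm' (fun u : (α × β) × (α × β) => f₀ u.1.1 u.2.1 - f₁ u.1.2 u.2.2) p (μ.prod μ) := by
  have h := measurable_gauge_sub hf₀ hf₁
  rw [distortionP, eLpNorm', lintegral_prod _ (h.enorm.pow_const p).aemeasurable]
  simp only [Real.enorm_eq_ofReal_abs, ENNReal.ofReal_rpow_of_nonneg (abs_nonneg _) hp]

lemma distortionP_mono {α β : Type*} [MeasurableSpace α] [MeasurableSpace β] {p q : ℝ}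
    (hp : 0 < p) (hpq : p ≤ q) {f₀ : α → α → ℝ} {f₁ : β → β → ℝ} (μ : Measure (α × β))
    [IsProbabilityMeasure μ]
    (hf₀ : Measurable (Function.uncurry f₀)) (hf₁ : Measurable (Function.uncurry f₁)) :
    distortionP p f₀ f₁ μ ≤ distortionP q f₀ f₁ μ := by
  have h := measurable_gauge_sub hf₀ hf₁
  rw [distortionP_eq_eLpNorm' hp.le μ hf₀ hf₁, distortionP_eq_eLpNorm' (hp.le.trans hpq) μ hf₀ hf₁]
  exact eLpNorm'_le_eLpNorm'_of_exponent_le hp hpq _ h.aestronglyMeasurable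

lemma abs_rpow_le_rpow_sub_mul {t L p q : ℝ} (hp : 0 ≤ p) (hpq : p ≤ q) (h : |t| ≤ L) :
    |t| ^ q ≤ L ^ (q - p) * |t| ^ p := by
  have hq : |t| ^ q = |t| ^ (q - p) * |t| ^ p := by
    rw [← Real.rpow_add_of_nonneg (abs_nonneg t) (sub_nonneg.2 hpq) hp, sub_add_cancel]
  rw [hq]
  gcongr

lemma distortionP_rpow_le {α β : Type*} [MeasurableSpace α] [MeasurableSpace β] {p q L : ℝ}
    (hp : 0 < p) (hpq : p ≤ q) (hL : 0 ≤ L) {f₀ : α → α → ℝ} {f₁ : β → β → ℝ}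
    (μ : Measure (α × β))
    (h : ∀ᵐ z ∂μ, ∀ᵐ w ∂μ, |f₀ z.1 w.1 - f₁ z.2 w.2| ≤ L) :
    distortionP q f₀ f₁ μ ^ q ≤ ENNReal.ofReal (L ^ (q - p)) * distortionP p f₀ f₁ μ ^ p := by
  rw [distortionP_rpow hp.ne', distortionP_rpow (hp.trans_le hpq).ne',
    ← lintegral_const_mul' _ _ ENNReal.ofReal_ne_top]
  refine lintegral_mono_ae (h.mono fun z hz => ?_)
  rw [← lintegral_const_mul' _ _ ENNReal.ofReal_ne_top]
  refine lintegral_mono_ae (hz.mono fun w hw => ?_)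
  rw [← ENNReal.ofReal_mul (Real.rpow_nonneg hL _)]
  exact ENNReal.ofReal_le_ofReal (abs_rpow_le_rpow_sub_mul hp.le hpq hw)

lemma le_mul_DDp_rpow {α β : Type*} [MeasurableSpace α] [MeasurableSpace β] {p : ℝ}
    (hp : 0 ≤ p) {f₀ : α → α → ℝ} {f₁ : β → β → ℝ} {m₀ : Measure α} {m₁ : Measure β}
    [IsProbabilityMeasure m₀] [IsProbabilityMeasure m₁] {a c : ℝ≥0∞} (hc : c ≠ ⊤)
    (h : ∀ μ ∈ Cpl m₀ m₁, a ≤ c * distortionP p f₀ f₁ μ ^ p) :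
    a ≤ c * DDp p f₀ f₁ m₀ m₁ ^ p := by
  have : Nonempty (Cpl m₀ m₁) := ⟨⟨_, prod_mem_Cpl m₀ m₁⟩⟩
  have hmono : Monotone fun t : ℝ≥0∞ => c * t ^ p := fun s t hst => by
    dsimp only
    gcongr
  have hcont : Continuous fun t : ℝ≥0∞ => c * t ^ p :=
    (ENNReal.continuous_const_mul hc).comp ENNReal.continuous_rpow_const
  rw [DDp, iInf_subtype']
  refine le_of_le_of_eq (le_iInf fun μ : Cpl m₀ m₁ => h μ.1 μ.2) ?_
  exact (Monotone.map_ciInf_of_continuousAt hcont.continuousAt hmono (OrderBot.bddBelow _)).symm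

/-- For `1 ≤ p ≤ q < ∞` and metric measure spaces of finite
`L^q`-size one has `DD_p ≤ DD_q`; if moreover both supports have diameter at most
`L`, then `DD_q ^ q ≤ L^(q−p) · DD_p ^ p`. -/
theorem DDp_mono_and_reverse_estimate
    {X₀ X₁ : Type*}
    [MetricSpace X₀] [CompleteSpace X₀] [TopologicalSpace.SeparableSpace X₀]
    [MeasurableSpace X₀] [BorelSpace X₀]
    [MetricSpace X₁] [CompleteSpace X₁] [TopologicalSpace.SeparableSpace X₁]
    [MeasurableSpace X₁] [BorelSpace X₁]
    (p q : ℝ) (hp : 1 ≤ p) (hpq : p ≤ q)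
    (m₀ : Measure X₀) (m₁ : Measure X₁)
    [IsProbabilityMeasure m₀] [IsProbabilityMeasure m₁]
    (hsize₀ : (∫⁻ x, ∫⁻ y, ENNReal.ofReal (dist x y ^ q) ∂m₀ ∂m₀) ≠ ⊤)
    (hsize₁ : (∫⁻ x, ∫⁻ y, ENNReal.ofReal (dist x y ^ q) ∂m₁ ∂m₁) ≠ ⊤) :
    DDp p dist dist m₀ m₁ ≤ DDp q dist dist m₀ m₁ ∧
    ∀ L : ℝ, 0 ≤ L →
      (∀ x ∈ mSupport m₀, ∀ y ∈ mSupport m₀, dist x y ≤ L) →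
      (∀ x ∈ mSupport m₁, ∀ y ∈ mSupport m₁, dist x y ≤ L) →
      DDp q dist dist m₀ m₁ ^ q ≤
        ENNReal.ofReal (L ^ (q - p)) * DDp p dist dist m₀ m₁ ^ p := by
  have hp0 : 0 < p := zero_lt_one.trans_le hp
  have := UniformSpace.secondCountable_of_separable X₀
  have := UniformSpace.secondCountable_of_separable X₁
  refine ⟨?_, fun L hL hL₀ hL₁ => ?_⟩
  · refine iInf₂_mono fun μ hμ => ?_
    have := Cpl.isProbabilityMeasure hμ
    exact distortionP_mono hp0 hpq μ measurable_dist measurable_dist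
  · refine le_mul_DDp_rpow hp0.le ENNReal.ofReal_ne_top fun μ hμ => ?_
    have h₀ : ∀ᵐ z ∂μ, z.1 ∈ mSupport m₀ :=
      ae_of_ae_map measurable_fst.aemeasurable (hμ.1 ▸ ae_mem_mSupport m₀)
    have h₁ : ∀ᵐ z ∂μ, z.2 ∈ mSupport m₁ :=
      ae_of_ae_map measurable_snd.aemeasurable (hμ.2 ▸ ae_mem_mSupport m₁)
    refine le_trans (ENNReal.rpow_le_rpow (iInf₂_le μ hμ) (hp0.le.trans hpq))
      (distortionP_rpow_le hp0 hpq hL μ ?_)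
    filter_upwards [h₀, h₁] with z hz₀ hz₁
    filter_upwards [h₀, h₁] with w hw₀ hw₁
    exact abs_sub_le_of_nonneg_of_le dist_nonneg (hL₀ _ hz₀ _ hw₀) dist_nonneg (hL₁ _ hz₁ _ hw₁)
end

section
/- Let p ∈ [1,∞), let (X₀,d₀,m₀) and (X₁,d₁,m₁) be metric measure spaces of finite L^p-size, and let μ̄ ∈ Cpl(m₀,m₁) be an optimal coupling for DD_p. For t ∈ [0,1] let X_t denote the gauged measure space (X₀×X₁, d_t, μ̄) with gauge d_t((x₀,x₁),(y₀,y₁)) = (1−t) d₀(x₀,y₀) + t d₁(x₁,y₁). Then for all 0 ≤ s ≤ t ≤ 1: DD_p(X_s, X_t) = (t−s) · DD_p((X₀,d₀,m₀),(X₁,d₁,m₁)); moreover DD_p((X₀,d₀,m₀), X_t) = t · DD_p((X₀,d₀,m₀),(X₁,d₁,m₁)) and DD_p(X_t, (X₁,d₁,m₁)) = (1−t) · DD_p((X₀,d₀,m₀),(X₁,d₁,m₁)). In particular (X_t)_{0≤t≤1} is a geodesic connecting the two spaces. -/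
open MeasureTheory ENNReal

/-- The convex combination gauge `(1−t)·d₀ + t·d₁` on the product of two metric
spaces. -/
noncomputable def convexGauge {α β : Type*} [Dist α] [Dist β] (t : ℝ) :
    (α × β) → (α × β) → ℝ :=
  fun z w => (1 - t) * dist z.1 w.1 + t * dist z.2 w.2

/-- The `L^p`-size of a gauge, as a seminorm on the product of the measure with itself. -/
noncomputable def gaugeNorm {α : Type*} [MeasurableSpace α] (p : ℝ) (f : α → α → ℝ)
    (m : Measure α) : ℝ≥0∞ :=
  eLpNorm (Function.uncurry f) (ENNReal.ofReal p) (m.prod m)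

section Gauge

variable {α β γ δ : Type*} [MeasurableSpace α] [MeasurableSpace β] [MeasurableSpace γ]
  [MeasurableSpace δ] {p : ℝ}

lemma gaugeNorm_eq_lintegral (hp : 1 ≤ p) {f : α → α → ℝ}
    (hf : Measurable (Function.uncurry f)) (m : Measure α) [SFinite m] :
    gaugeNorm p f m = (∫⁻ x, ∫⁻ y, ENNReal.ofReal (|f x y| ^ p) ∂m ∂m) ^ (1 / p) := by
  have hp0 : 0 < p := by linarith
  rw [gaugeNorm, eLpNorm_eq_lintegral_rpow_enorm_toReal (by simpa using hp0)
    ENNReal.ofReal_ne_top, ENNReal.toReal_ofReal hp0.le, lintegral_prod _ (by fun_prop)]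
  simp only [Function.uncurry_apply_pair, Real.enorm_eq_ofReal_abs,
    ENNReal.ofReal_rpow_of_nonneg (abs_nonneg _) hp0.le]

lemma gaugeNorm_ne_top (hp : 1 ≤ p) {f : α → α → ℝ}
    (hf : Measurable (Function.uncurry f)) (hf0 : ∀ x y, 0 ≤ f x y) {m : Measure α} [SFinite m]
    (hm : (∫⁻ x, ∫⁻ y, ENNReal.ofReal (f x y ^ p) ∂m ∂m) ≠ ⊤) :
    gaugeNorm p f m ≠ ⊤ := by
  rw [gaugeNorm_eq_lintegral hp hf]
  simp only [abs_of_nonneg (hf0 _ _)]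
  exact ENNReal.rpow_ne_top_of_nonneg (by positivity) hm

lemma gaugeNorm_add_le (hp : 1 ≤ p) {f g : α → α → ℝ} (hf : Measurable (Function.uncurry f))
    (hg : Measurable (Function.uncurry g)) (m : Measure α) :
    gaugeNorm p (fun x y => f x y + g x y) m ≤ gaugeNorm p f m + gaugeNorm p g m :=
  eLpNorm_add_le hf.aestronglyMeasurable hg.aestronglyMeasurable
    (by simpa using ENNReal.ofReal_le_ofReal hp)

lemma gaugeNorm_sub_le (hp : 1 ≤ p) {f g : α → α → ℝ} (hf : Measurable (Function.uncurry f))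
    (hg : Measurable (Function.uncurry g)) (m : Measure α) :
    gaugeNorm p (fun x y => f x y - g x y) m ≤ gaugeNorm p f m + gaugeNorm p g m :=
  eLpNorm_sub_le hf.aestronglyMeasurable hg.aestronglyMeasurable
    (by simpa using ENNReal.ofReal_le_ofReal hp)

lemma gaugeNorm_const_mul {c : ℝ} (hc : 0 ≤ c) (f : α → α → ℝ) (m : Measure α) :
    gaugeNorm p (fun x y => c * f x y) m = ENNReal.ofReal c * gaugeNorm p f m := by
  rw [gaugeNorm, gaugeNorm, ← Real.enorm_of_nonneg hc, ← eLpNorm_const_smul]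
  rfl

lemma gaugeNorm_zero (m : Measure α) : gaugeNorm p (fun _ _ => 0) m = 0 :=
  eLpNorm_zero

lemma gaugeNorm_map {u : α → β} (hu : Measurable u) {f : β → β → ℝ}
    (hf : Measurable (Function.uncurry f)) (m : Measure α) [SFinite m] :
    gaugeNorm p f (m.map u) = gaugeNorm p (fun x y => f (u x) (u y)) m := by
  rw [gaugeNorm, Measure.map_prod_map _ _ hu hu,
    eLpNorm_map_measure hf.aestronglyMeasurable (by fun_prop)]
  rfl

lemma distortionP_eq_gaugeNorm (hp : 1 ≤ p) {f : α → α → ℝ} {g : β → β → ℝ}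
    (hf : Measurable (Function.uncurry f)) (hg : Measurable (Function.uncurry g))
    (ν : Measure (α × β)) [SFinite ν] :
    distortionP p f g ν = gaugeNorm p (fun z w => f z.1 w.1 - g z.2 w.2) ν := by
  rw [gaugeNorm_eq_lintegral hp, distortionP]
  exact (hf.comp (by fun_prop : Measurable fun q : (α × β) × (α × β) => (q.1.1, q.2.1))).sub
    (hg.comp (by fun_prop : Measurable fun q : (α × β) × (α × β) => (q.1.2, q.2.2)))

lemma isProbabilityMeasure_of_mem_Cpl {m₀ : Measure α} {m₁ : Measure β}
    [IsProbabilityMeasure m₀] {ν : Measure (α × β)} (hν : ν ∈ Cpl m₀ m₁) :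
    IsProbabilityMeasure ν := by
  constructor
  rw [← Set.preimage_univ (f := Prod.fst), ← Measure.map_apply measurable_fst .univ, hν.1,
    measure_univ]

/-- Any two maps out of a probability space realise a coupling of the pushforwards. -/
lemma DDp_map_le (hp : 1 ≤ p) (m : Measure α) [IsProbabilityMeasure m] {u : α → β} {v : α → γ}
    (hu : Measurable u) (hv : Measurable v) {f : β → β → ℝ} {g : γ → γ → ℝ}
    (hf : Measurable (Function.uncurry f)) (hg : Measurable (Function.uncurry g)) :
    DDp p f g (m.map u) (m.map v) ≤
      gaugeNorm p (fun x y => f (u x) (u y) - g (v x) (v y)) m := by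
  have huv : Measurable fun x => (u x, v x) := hu.prodMk hv
  have hmem : m.map (fun x => (u x, v x)) ∈ Cpl (m.map u) (m.map v) :=
    ⟨by rw [Measure.map_map measurable_fst huv]; rfl,
      by rw [Measure.map_map measurable_snd huv]; rfl⟩
  refine (iInf₂_le _ hmem).trans_eq ?_
  rw [distortionP_eq_gaugeNorm hp hf hg, gaugeNorm_map huv]
  exact (hf.comp (by fun_prop : Measurable fun q : (β × γ) × (β × γ) => (q.1.1, q.2.1))).sub
    (hg.comp (by fun_prop : Measurable fun q : (β × γ) × (β × γ) => (q.1.2, q.2.2)))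

/-- Comparison of the distortion distance between two spaces with the one between images
of these spaces, up to the change of the gauges. -/
lemma DDp_map_map_le (hp : 1 ≤ p) (m : Measure α) (n : Measure β) [IsProbabilityMeasure m]
    {u : α → γ} {v : β → δ} (hu : Measurable u) (hv : Measurable v)
    {f : α → α → ℝ} {g : β → β → ℝ} {f' : γ → γ → ℝ} {g' : δ → δ → ℝ}
    (hf : Measurable (Function.uncurry f)) (hg : Measurable (Function.uncurry g))
    (hf' : Measurable (Function.uncurry f')) (hg' : Measurable (Function.uncurry g')) :
    DDp p f' g' (m.map u) (n.map v) ≤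
      gaugeNorm p (fun x y => f' (u x) (u y) - f x y) m + DDp p f g m n +
        gaugeNorm p (fun x y => g x y - g' (v x) (v y)) n := by
  simp only [DDp.eq_def p f g, ENNReal.add_iInf, ENNReal.iInf_add]
  refine le_iInf₂ fun ν hν => ?_
  have := isProbabilityMeasure_of_mem_Cpl hν
  have hfst : Measurable fun q : (α × β) × (α × β) => (q.1.1, q.2.1) := by fun_prop
  have hsnd : Measurable fun q : (α × β) × (α × β) => (q.1.2, q.2.2) := by fun_prop
  have hA : Measurable (Function.uncurry fun x y => f' (u x) (u y) - f x y) :=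
    (hf'.comp (hu.prodMap hu)).sub hf
  have hB : Measurable (Function.uncurry fun x y => g x y - g' (v x) (v y)) :=
    hg.sub (hg'.comp (hv.prodMap hv))
  have hC : Measurable (Function.uncurry fun z w : α × β => f z.1 w.1 - g z.2 w.2) :=
    (hf.comp hfst).sub (hg.comp hsnd)
  have hle := DDp_map_le hp ν (hu.comp measurable_fst) (hv.comp measurable_snd) hf' hg'
  rw [← Measure.map_map hu measurable_fst, ← Measure.map_map hv measurable_snd, hν.1,
    hν.2] at hle
  refine hle.trans ?_
  rw [distortionP_eq_gaugeNorm hp hf hg]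
  conv_rhs => rw [← hν.1, ← hν.2]
  rw [gaugeNorm_map measurable_fst hA, gaugeNorm_map measurable_snd hB]
  have hA' : Measurable (Function.uncurry fun z w : α × β => f' (u z.1) (u w.1) - f z.1 w.1) :=
    hA.comp hfst
  have hB' : Measurable (Function.uncurry fun z w : α × β => g z.2 w.2 - g' (v z.2) (v w.2)) :=
    hB.comp hsnd
  have hsum := (gaugeNorm_add_le hp (hA'.add hC) hB' ν).trans
    (add_le_add (gaugeNorm_add_le hp hA' hC ν) le_rfl)
  refine le_trans (le_of_eq ?_) hsum
  congr 1
  funext z w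
  simp

end Gauge

lemma ENNReal.ofReal_mul_le_of_le_add {D X : ℝ≥0∞} (hD : D ≠ ⊤) {a b c : ℝ} (ha : 0 ≤ a)
    (hb : 0 ≤ b) (hc : 0 ≤ c) (habc : a + c + b = 1)
    (h : D ≤ ENNReal.ofReal a * D + X + ENNReal.ofReal b * D) : ENNReal.ofReal c * D ≤ X := by
  have hsum : ENNReal.ofReal c * D + (ENNReal.ofReal a * D + ENNReal.ofReal b * D) = D := by
    rw [← add_mul, ← add_mul, ← ENNReal.ofReal_add ha hb, ← ENNReal.ofReal_add hc (by positivity),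
      show c + (a + b) = 1 by linarith, ENNReal.ofReal_one, one_mul]
  have hfin : ENNReal.ofReal a * D + ENNReal.ofReal b * D ≠ ⊤ := by finiteness
  refine (ENNReal.add_le_add_iff_right hfin).1 ?_
  rw [hsum]
  exact h.trans_eq (by ring)

lemma measurable_uncurry_convexGauge {α β : Type*} [MetricSpace α] [MetricSpace β]
    [SecondCountableTopology α] [SecondCountableTopology β] [MeasurableSpace α] [BorelSpace α]
    [MeasurableSpace β] [BorelSpace β] (t : ℝ) :
    Measurable (Function.uncurry (convexGauge (α := α) (β := β) t)) := by
  unfold convexGauge Function.uncurry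
  fun_prop

/-- Let `μ` be an optimal coupling (for `DD_p`, `1 ≤ p < ∞`) of two
metric measure spaces of finite `L^p`-size, and for `t ∈ [0,1]` let `X_t` be the
gauged measure space `(X₀ × X₁, (1−t)d₀ + t d₁, μ)`. Then
`DD_p(X_s, X_t) = (t−s) · DD_p(X₀, X₁)` for `0 ≤ s ≤ t ≤ 1`, and moreover
`DD_p(X₀, X_t) = t · DD_p(X₀, X₁)` and `DD_p(X_t, X₁) = (1−t) · DD_p(X₀, X₁)`;
in particular `(X_t)` is a geodesic connecting the two spaces. -/
theorem optimal_coupling_gives_geodesic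
    {X₀ X₁ : Type*}
    [MetricSpace X₀] [CompleteSpace X₀] [TopologicalSpace.SeparableSpace X₀]
    [MeasurableSpace X₀] [BorelSpace X₀]
    [MetricSpace X₁] [CompleteSpace X₁] [TopologicalSpace.SeparableSpace X₁]
    [MeasurableSpace X₁] [BorelSpace X₁]
    (p : ℝ) (hp : 1 ≤ p)
    (m₀ : Measure X₀) (m₁ : Measure X₁)
    [IsProbabilityMeasure m₀] [IsProbabilityMeasure m₁]
    (hsize₀ : (∫⁻ x, ∫⁻ y, ENNReal.ofReal (dist x y ^ p) ∂m₀ ∂m₀) ≠ ⊤)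
    (hsize₁ : (∫⁻ x, ∫⁻ y, ENNReal.ofReal (dist x y ^ p) ∂m₁ ∂m₁) ≠ ⊤)
    (μ : Measure (X₀ × X₁)) (hμ : μ ∈ Cpl m₀ m₁)
    (hopt : distortionP p dist dist μ = DDp p dist dist m₀ m₁) :
    (∀ s t : ℝ, 0 ≤ s → s ≤ t → t ≤ 1 →
        DDp p (convexGauge s) (convexGauge t) μ μ =
          ENNReal.ofReal (t - s) * DDp p dist dist m₀ m₁) ∧
    (∀ t : ℝ, 0 ≤ t → t ≤ 1 →
        DDp p dist (convexGauge t) m₀ μ =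
          ENNReal.ofReal t * DDp p dist dist m₀ m₁) ∧
    (∀ t : ℝ, 0 ≤ t → t ≤ 1 →
        DDp p (convexGauge t) dist μ m₁ =
          ENNReal.ofReal (1 - t) * DDp p dist dist m₀ m₁) := by
  have := UniformSpace.secondCountable_of_separable X₀
  have := UniformSpace.secondCountable_of_separable X₁
  have := isProbabilityMeasure_of_mem_Cpl hμ
  have hd₀ : Measurable (Function.uncurry (dist : X₀ → X₀ → ℝ)) := measurable_dist
  have hd₁ : Measurable (Function.uncurry (dist : X₁ → X₁ → ℝ)) := measurable_dist
  have hg := measurable_uncurry_convexGauge (α := X₀) (β := X₁)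
  have hd₀' : Measurable (Function.uncurry fun z w : X₀ × X₁ => dist z.1 w.1) := by
    unfold Function.uncurry; fun_prop
  have hd₁' : Measurable (Function.uncurry fun z w : X₀ × X₁ => dist z.2 w.2) := by
    unfold Function.uncurry; fun_prop
  rw [distortionP_eq_gaugeNorm hp hd₀ hd₁] at hopt
  have hD : DDp p dist dist m₀ m₁ ≠ ⊤ := by
    have h₀ := gaugeNorm_ne_top hp hd₀ (fun _ _ => dist_nonneg) hsize₀
    have h₁ := gaugeNorm_ne_top hp hd₁ (fun _ _ => dist_nonneg) hsize₁
    rw [← hμ.1, gaugeNorm_map measurable_fst hd₀] at h₀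
    rw [← hμ.2, gaugeNorm_map measurable_snd hd₁] at h₁
    rw [← hopt]
    exact ne_top_of_le_ne_top (ENNReal.add_ne_top.2 ⟨h₀, h₁⟩) (gaugeNorm_sub_le hp hd₀' hd₁' μ)
  have hmul : ∀ c : ℝ, 0 ≤ c → ∀ f : X₀ × X₁ → X₀ × X₁ → ℝ,
      (∀ z w, f z w = c * (dist z.1 w.1 - dist z.2 w.2)) →
      gaugeNorm p f μ = ENNReal.ofReal c * DDp p dist dist m₀ m₁ := by
    intro c hc f hf
    rw [← hopt, ← gaugeNorm_const_mul hc]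
    congr 1
    funext z w
    exact hf z w
  have hleft : ∀ t : ℝ, 0 ≤ t →
      gaugeNorm p (fun z w : X₀ × X₁ => dist z.1 w.1 - convexGauge t z w) μ =
        ENNReal.ofReal t * DDp p dist dist m₀ m₁ := fun t ht =>
    hmul t ht _ fun z w => by unfold convexGauge; ring
  have hright : ∀ t : ℝ, t ≤ 1 →
      gaugeNorm p (fun z w : X₀ × X₁ => convexGauge t z w - dist z.2 w.2) μ =
        ENNReal.ofReal (1 - t) * DDp p dist dist m₀ m₁ := fun t ht =>
    hmul (1 - t) (by linarith) _ fun z w => by unfold convexGauge; ring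
  refine ⟨fun s t hs hst ht => le_antisymm ?_ ?_, fun t ht0 ht1 => le_antisymm ?_ ?_,
    fun t ht0 ht1 => le_antisymm ?_ ?_⟩
  · have h := DDp_map_le hp μ measurable_id measurable_id (hg s) (hg t)
    rw [Measure.map_id] at h
    exact h.trans_eq (hmul (t - s) (by linarith) _ fun z w => by
      simp only [convexGauge, id]; ring)
  · have h := DDp_map_map_le hp μ μ measurable_fst measurable_snd (hg s) (hg t) hd₀ hd₁
    rw [hμ.1, hμ.2, hleft s hs, hright t ht] at h
    exact ENNReal.ofReal_mul_le_of_le_add hD hs (by linarith) (by linarith) (by ring) h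
  · have h := DDp_map_le hp μ measurable_fst measurable_id hd₀ (hg t)
    rw [Measure.map_id, hμ.1] at h
    exact h.trans_eq (hleft t ht0)
  · have h := DDp_map_map_le hp m₀ μ measurable_id measurable_snd hd₀ (hg t) hd₀ hd₁
    simp only [id, sub_self, gaugeNorm_zero] at h
    rw [Measure.map_id, hμ.2, hright t ht1] at h
    exact ENNReal.ofReal_mul_le_of_le_add (b := 1 - t) hD le_rfl (by linarith) ht0 (by ring)
      (by simpa using h)
  · have h := DDp_map_le hp μ measurable_id measurable_snd (hg t) hd₁
    rw [Measure.map_id, hμ.2] at h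
    exact h.trans_eq (hright t ht1)
  · have h := DDp_map_map_le hp μ m₁ measurable_fst measurable_id (hg t) hd₁ hd₀ hd₁
    simp only [id, sub_self, gaugeNorm_zero] at h
    rw [Measure.map_id, hμ.1, hleft t ht0] at h
    exact ENNReal.ofReal_mul_le_of_le_add hD ht0 le_rfl (by linarith) (by ring)
      (by simpa using h)
end
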